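/- Let d ∈ ℕ, let a b : Fin d → ℝ satisfy a i > 0 and b i > 0 for all i, let ε ≥ 0, and let r ∈ EuclideanSpace ℝ (Fin d) with c̄(r) > ε. Define sign-selected weights w : Fin d → ℝ by w i = b i if r i ≥ 0 and w i = a i if r i < 0. Then there exists λ ≥ 0 such that the vector δ* with coordinates δ* i = (Real.sign (r i)) * max (|r i| − λ * w i) 0 satisfies c̄(δ*) = ε and is the unique minimizer of ‖r − δ‖ over K(ε); that is, sign-flipped weighted soft-thresholding computes the Euclidean projection of r onto the asymmetric cost ball K(ε). (This is the mathematical content of Statement 1 of the paper: the cost-ball projection algorithm is a valid projection onto K(ε).) -/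

import Mathlib

/-- The asymmetric weighted-ℓ1 cost
`c̄(δ) = ∑ i, (a i * max (-(δ i)) 0 + b i * max (δ i) 0)`. -/
noncomputable def cbar {d : ℕ} (a b : Fin d → ℝ) (δ : EuclideanSpace ℝ (Fin d)) : ℝ :=
  ∑ i, (a i * max (-(δ i)) 0 + b i * max (δ i) 0)

/-- The cost ball `K(ε) = {δ | c̄(δ) ≤ ε}`. -/
noncomputable def costBall {d : ℕ} (a b : Fin d → ℝ) (ε : ℝ) :
    Set (EuclideanSpace ℝ (Fin d)) :=
  {δ | cbar a b δ ≤ ε}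

/-- Variational inequality for scalar soft-thresholding at a nonnegative point. -/
lemma soft_threshold_variational {a b lam r : ℝ} (ha : 0 < a) (hb : 0 < b) (hlam : 0 ≤ lam)
    (hr : 0 ≤ r) (x : ℝ) :
    (r - max (r - lam * b) 0) * (x - max (r - lam * b) 0) ≤
      lam * (a * max (-x) 0 + b * max x 0 - b * max (r - lam * b) 0) := by
  have h1 : b * x ≤ a * max (-x) 0 + b * max x 0 := by
    have := mul_nonneg ha.le (le_max_right (-x) 0)
    have := mul_le_mul_of_nonneg_left (le_max_left x 0) hb.le
    linarith
  have h2 : 0 ≤ a * max (-x) 0 + b * max x 0 := by positivity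
  rcases le_total (r - lam * b) 0 with h | h
  · rw [max_eq_right h]
    rcases le_total 0 x with hx | hx
    · nlinarith [mul_le_mul_of_nonneg_left h1 hlam, mul_nonneg hx (neg_nonneg.2 h)]
    · nlinarith [mul_nonneg hlam h2, mul_nonneg hr (neg_nonneg.2 hx)]
  · rw [max_eq_left h]
    nlinarith [mul_le_mul_of_nonneg_left h1 hlam]

/-- The one-dimensional cost of the sign-selected soft-thresholded value. -/
lemma cost_sign_mul_max {a b w r : ℝ} (hw : w = if 0 ≤ r then b else a) {t : ℝ}
    (ht : 0 ≤ t) (h0 : r = 0 → t = 0) :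
    a * max (-(Real.sign r * t)) 0 + b * max (Real.sign r * t) 0 = w * t := by
  rcases lt_trichotomy r 0 with h | h | h
  · simp [hw, Real.sign_of_neg h, ht, h.not_ge]
  · simp [h0 h]
  · simp [hw, Real.sign_of_pos h, ht, h.le]

/-- Variational inequality for scalar sign-selected soft-thresholding. -/
lemma sign_soft_threshold_variational {a b w lam r : ℝ} (ha : 0 < a) (hb : 0 < b)
    (hlam : 0 ≤ lam) (hw : w = if 0 ≤ r then b else a) (x : ℝ) :
    (r - Real.sign r * max (|r| - lam * w) 0) * (x - Real.sign r * max (|r| - lam * w) 0) ≤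
      lam * (a * max (-x) 0 + b * max x 0 - w * max (|r| - lam * w) 0) := by
  rcases lt_trichotomy r 0 with h | h | h
  · have := soft_threshold_variational hb ha hlam (neg_nonneg.2 h.le) (-x)
    rw [neg_neg] at this
    rw [hw, if_neg h.not_ge, Real.sign_of_neg h, abs_of_neg h]
    linarith
  · subst h
    have := soft_threshold_variational ha hb hlam le_rfl x
    have h2 : max (-(lam * b)) 0 = 0 := max_eq_right (by nlinarith)
    simpa [hw, h2] using this
  · rw [hw, if_pos h.le, Real.sign_of_pos h, abs_of_pos h, one_mul]
    exact soft_threshold_variational ha hb hlam h.le x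

/-- The total weighted soft-thresholded mass attains every value between `0` and its value
at threshold `0`. -/
lemma exists_soft_threshold_sum_eq {ι : Type*} [Fintype ι] {w u : ι → ℝ} (hw : ∀ i, 0 < w i)
    (hu : ∀ i, 0 ≤ u i) {ε : ℝ} (hε : 0 ≤ ε) (h : ε ≤ ∑ i, w i * u i) :
    ∃ lam : ℝ, 0 ≤ lam ∧ ∑ i, w i * max (u i - lam * w i) 0 = ε := by
  have hq : ∀ i, 0 ≤ u i / w i := fun i => div_nonneg (hu i) (hw i).le
  have hL : 0 ≤ ∑ i, u i / w i := Finset.sum_nonneg fun i _ => hq i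
  have hcont : Continuous fun lam : ℝ => ∑ i, w i * max (u i - lam * w i) 0 := by fun_prop
  have hend : ∑ i, w i * max (u i - (∑ j, u j / w j) * w i) 0 = 0 := by
    refine Finset.sum_eq_zero fun i _ => ?_
    have h1 : u i / w i ≤ ∑ j, u j / w j :=
      Finset.single_le_sum (fun j _ => hq j) (Finset.mem_univ i)
    rw [div_le_iff₀ (hw i)] at h1
    rw [max_eq_right (by linarith), mul_zero]
  have hstart : ∑ i, w i * max (u i - 0 * w i) 0 = ∑ i, w i * u i := by simp [hu]
  obtain ⟨lam, hlam, heq⟩ := intermediate_value_Icc' hL hcont.continuousOn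
    (show ε ∈ Set.Icc _ _ from ⟨hend.trans_le hε, h.trans_eq hstart.symm⟩)
  exact ⟨lam, hlam.1, heq⟩

/-- Validity of the cost-ball projection algorithm: if `c̄(r) > ε`, there is `λ ≥ 0` such
that the sign-flipped weighted soft-thresholded vector
`δ* i = sign (r i) * max (|r i| − λ * w i) 0`, with sign-selected weights
`w i = b i` if `r i ≥ 0` and `w i = a i` otherwise, has active cost `c̄(δ*) = ε` and is
the unique Euclidean-nearest point of `K(ε)` to `r`. -/
theorem stmt_8 {d : ℕ} (a b : Fin d → ℝ) (ha : ∀ i, 0 < a i) (hb : ∀ i, 0 < b i)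
    (ε : ℝ) (hε : 0 ≤ ε) (r : EuclideanSpace ℝ (Fin d)) (hr : cbar a b r > ε)
    (w : Fin d → ℝ) (hw : ∀ i, w i = if 0 ≤ r i then b i else a i) :
    ∃ lam : ℝ, 0 ≤ lam ∧
      ∀ δstar : EuclideanSpace ℝ (Fin d),
        (∀ i, δstar i = Real.sign (r i) * max (|r i| - lam * w i) 0) →
          cbar a b δstar = ε ∧ δstar ∈ costBall a b ε ∧
            ∀ δ ∈ costBall a b ε,
              ‖r - δstar‖ ≤ ‖r - δ‖ ∧ (δ ≠ δstar → ‖r - δstar‖ < ‖r - δ‖) := by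
  have hw0 : ∀ i, 0 < w i := fun i => by
    rw [hw i]
    split_ifs
    exacts [hb i, ha i]
  have hcost : cbar a b r = ∑ i, w i * |r i| := by
    refine Finset.sum_congr rfl fun i _ => ?_
    rw [← cost_sign_mul_max (hw i) (abs_nonneg (r i)) (fun h => by simp [h]),
      show Real.sign (r i) * |r i| = r i from ?_]
    rcases lt_trichotomy (r i) 0 with h | h | h
    · rw [Real.sign_of_neg h, abs_of_neg h, neg_one_mul, neg_neg]
    · simp [h]
    · rw [Real.sign_of_pos h, abs_of_pos h, one_mul]
  obtain ⟨lam, hlam, hsum⟩ := exists_soft_threshold_sum_eq hw0 (fun i => abs_nonneg (r i)) hε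
    (hcost ▸ hr.le)
  refine ⟨lam, hlam, fun δstar hδ => ?_⟩
  have hstar : cbar a b δstar = ε := by
    rw [← hsum]
    refine Finset.sum_congr rfl fun i _ => ?_
    rw [hδ i]
    refine cost_sign_mul_max (hw i) (le_max_right _ _) fun h => max_eq_right ?_
    rw [h, abs_zero]
    linarith [mul_nonneg hlam (hw0 i).le]
  refine ⟨hstar, hstar.le, fun δ hδK => ?_⟩
  have hvar : ∑ i, (r i - δstar i) * (δ i - δstar i) ≤ 0 := by
    calc ∑ i, (r i - δstar i) * (δ i - δstar i)
        ≤ ∑ i, lam * (a i * max (-(δ i)) 0 + b i * max (δ i) 0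
            - w i * max (|r i| - lam * w i) 0) := Finset.sum_le_sum fun i _ => by
          rw [hδ i]
          exact sign_soft_threshold_variational (ha i) (hb i) hlam (hw i) (δ i)
      _ = lam * (cbar a b δ - ε) := by
          rw [← Finset.mul_sum, Finset.sum_sub_distrib, hsum, cbar]
      _ ≤ 0 := mul_nonpos_of_nonneg_of_nonpos hlam (sub_nonpos.2 hδK)
  have hpyth : ‖r - δstar‖ ^ 2 + ‖δ - δstar‖ ^ 2 ≤ ‖r - δ‖ ^ 2 := by
    have hid : ‖r - δ‖ ^ 2 = ‖r - δstar‖ ^ 2 + ‖δ - δstar‖ ^ 2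
        - 2 * ∑ i, (r i - δstar i) * (δ i - δstar i) := by
      simp only [EuclideanSpace.real_norm_sq_eq, PiLp.sub_apply, Finset.mul_sum,
        ← Finset.sum_add_distrib, ← Finset.sum_sub_distrib]
      exact Finset.sum_congr rfl fun i _ => by ring
    linarith
  refine ⟨(abs_le_of_sq_le_sq' ?_ (norm_nonneg _)).2, fun hne => lt_of_pow_lt_pow_left₀ 2 (norm_nonneg _) ?_⟩
  · nlinarith [sq_nonneg ‖δ - δstar‖]
  · have := pow_pos (norm_pos_iff.2 (sub_ne_zero.2 hne)) 2
    linarith
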